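/- Let (Ω,F,P) be a probability space and (X_n) a sequence of ℝ^d-valued random vectors with nonnegative components such that for each i ∈ {1,…,d}, sup_n E[X_n^i] < ∞. Then there exists a subsequence (X_{n_k}) and an ℝ^d-valued random vector Y such that the Cesàro means (1/N) Σ_{k=1}^N X_{n_k} converge to Y almost surely. -/

import Mathlib

open MeasureTheory Finset

/-- A bounded sequence in a Hilbert space has a weak limit along every ultrafilter. -/
theorem exists_tendsto_inner_of_norm_le {H : Type*} [NormedAddCommGroup H] [InnerProductSpace ℝ H]
    [CompleteSpace H] (U : Ultrafilter ℕ) (f : ℕ → H) (R : ℝ) (hf : ∀ m, ‖f m‖ ≤ R) :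
    ∃ x : H, ∀ g : H, Filter.Tendsto (fun m ↦ inner ℝ (f m) g) U (nhds (inner ℝ x g)) := by
  let F : ℕ → WeakDual ℝ H := fun m ↦ StrongDual.toWeakDual (InnerProductSpace.toDual ℝ H (f m))
  obtain ⟨y, -, hy⟩ :=
    (WeakDual.isCompact_closedBall (𝕜 := ℝ) (E := H) 0 R).ultrafilter_le_nhds' (U.map F)
      (Ultrafilter.mem_map.2 <| Filter.Eventually.of_forall fun m ↦ by simpa [F] using hf m)
  refine ⟨(InnerProductSpace.toDual ℝ H).symm (WeakDual.toStrongDual y), fun g ↦ ?_⟩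
  rw [InnerProductSpace.toDual_symm_apply]
  exact ((WeakDual.eval_continuous g).tendsto y).comp hy

/-- A bounded real sequence has a limit along every ultrafilter. -/
theorem exists_tendsto_of_mem_Icc (U : Ultrafilter ℕ) (f : ℕ → ℝ) (a b : ℝ)
    (hf : ∀ m, f m ∈ Set.Icc a b) : ∃ x : ℝ, Filter.Tendsto f U (nhds x) := by
  obtain ⟨y, -, hy⟩ := (isCompact_Icc (a := a) (b := b)).ultrafilter_le_nhds' (U.map f)
    (Ultrafilter.mem_map.2 <| Filter.Eventually.of_forall hf)
  exact ⟨y, hy⟩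

/-- Sequences can be built recursively, subject to constraints between each term and all of its
predecessors that can always be met. -/
theorem exists_seq_of_forall_exists (S : ℕ → ℕ → Prop) (R : ℕ → ℕ → ℕ → ℕ → Prop)
    (h : ∀ (n : ℕ) (p : ℕ → ℕ), ∃ m, S n m ∧ ∀ j < n, R j (p j) n m) :
    ∃ φ : ℕ → ℕ, (∀ n, S n (φ n)) ∧ ∀ n, ∀ j < n, R j (φ j) n (φ n) := by
  choose c hcS hcR using h
  let F : ℕ → ℕ → ℕ := fun n ↦
    Nat.rec (fun _ ↦ 0) (fun n p ↦ Function.update p n (c n p)) n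
  have hF : ∀ n, F (n + 1) = Function.update (F n) n (c n (F n)) := fun n ↦ rfl
  have hstable : ∀ n, ∀ j < n, F n j = F (j + 1) j := by
    intro n
    induction n with
    | zero => simp
    | succ n ih =>
      intro j hj
      rcases (Nat.lt_succ_iff.mp hj).eq_or_lt with rfl | hlt
      · rfl
      · rw [hF n, Function.update_of_ne hlt.ne, ih j hlt]
  have hlast : ∀ n, F (n + 1) n = c n (F n) := fun n ↦ by rw [hF, Function.update_self]
  refine ⟨fun n ↦ F (n + 1) n, fun n ↦ ?_, fun n j hj ↦ ?_⟩
  · simpa only [hlast] using hcS n (F n)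
  · have := hcR n (F n) j hj
    rwa [hstable n j hj, ← hlast n] at this

/-- Nonnegative functions with summable integrals are almost everywhere summable. -/
theorem ae_summable_of_summable_integral {Ω : Type*} [MeasurableSpace Ω] {μ : Measure Ω}
    (f : ℕ → Ω → ℝ) (hf : ∀ n, Integrable (f n) μ) (hpos : ∀ n, 0 ≤ᵐ[μ] f n)
    (hsum : Summable fun n ↦ ∫ ω, f n ω ∂μ) : ∀ᵐ ω ∂μ, Summable fun n ↦ f n ω := by
  have hmeas : ∀ n, AEMeasurable (fun ω ↦ ENNReal.ofReal (f n ω)) μ :=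
    fun n ↦ (hf n).aemeasurable.ennreal_ofReal
  have hfin : ∫⁻ ω, ∑' n, ENNReal.ofReal (f n ω) ∂μ ≠ ⊤ := by
    rw [lintegral_tsum hmeas]
    simp_rw [← fun n ↦ ofReal_integral_eq_lintegral_ofReal (hf n) (hpos n)]
    exact hsum.tsum_ofReal_ne_top
  filter_upwards [ae_lt_top' (AEMeasurable.tsum hmeas) hfin, ae_all_iff.2 hpos] with ω h1 h2
  refine (ENNReal.summable_toReal h1.ne).congr fun n ↦ ?_
  exact ENNReal.toReal_ofReal (h2 n)

/-- Almost orthogonal vectors satisfy an approximate Bessel-type bound for their partial sums. -/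
theorem norm_sum_range_sq_le {H : Type*} [NormedAddCommGroup H] [InnerProductSpace ℝ H]
    (D : ℕ → H) (ε : ℕ → ℝ) (hD : ∀ n, ∀ j < n, inner ℝ (D j) (D n) ≤ ε n) (N : ℕ) :
    ‖∑ n ∈ range N, D n‖ ^ 2 ≤ ∑ n ∈ range N, (‖D n‖ ^ 2 + 2 * (n * ε n)) := by
  induction N with
  | zero => simp
  | succ N ih =>
    rw [sum_range_succ, sum_range_succ, norm_add_sq_real, sum_inner]
    have : ∑ j ∈ range N, inner ℝ (D j) (D N) ≤ N * ε N := by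
      simpa using sum_le_card_nsmul (range N) _ (ε N) fun j hj ↦ hD N j (mem_range.1 hj)
    linarith

/-- The reciprocals of the integer parts `⌊c ^ k⌋₊` exceeding `j` sum to `O(1 / (j + 1))`. -/
theorem sum_inv_nat_floor_pow_le {c : ℝ} (hc : 1 < c) (j K : ℕ) :
    ∑ k ∈ range K with j < ⌊c ^ k⌋₊, ((⌊c ^ k⌋₊ : ℝ))⁻¹ ≤ (1 - c⁻¹)⁻¹ ^ 2 / (j + 1) := by
  have c0 : 0 < c := by linarith
  have hA : 0 < 1 - c⁻¹ := sub_pos.2 (inv_lt_one_of_one_lt₀ hc)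
  have hex : ∃ k, j < ⌊c ^ k⌋₊ := by
    obtain ⟨k, hk⟩ := pow_unbounded_of_one_lt ((j : ℝ) + 1) hc
    exact ⟨k, Nat.le_floor (by push_cast; exact hk.le)⟩
  classical
  set k₀ := Nat.find hex with hk₀
  have hk₀c : (j : ℝ) + 1 ≤ c ^ k₀ := by
    have h1 : j + 1 ≤ ⌊c ^ k₀⌋₊ := Nat.find_spec hex
    have h2 : (⌊c ^ k₀⌋₊ : ℝ) ≤ c ^ k₀ := Nat.floor_le (by positivity)
    have h3 : ((j + 1 : ℕ) : ℝ) ≤ ⌊c ^ k₀⌋₊ := by exact_mod_cast h1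
    push_cast at h3
    linarith
  calc ∑ k ∈ range K with j < ⌊c ^ k⌋₊, ((⌊c ^ k⌋₊ : ℝ))⁻¹
      ≤ ∑ k ∈ range K with j < ⌊c ^ k⌋₊, (1 - c⁻¹)⁻¹ * c⁻¹ ^ k := by
        refine sum_le_sum fun k _ ↦ ?_
        rw [inv_pow, ← mul_inv]
        exact inv_anti₀ (by positivity) (mul_pow_le_nat_floor_pow hc k)
    _ ≤ ∑ k ∈ Ico k₀ K, (1 - c⁻¹)⁻¹ * c⁻¹ ^ k := by
        refine sum_le_sum_of_subset_of_nonneg (fun k hk ↦ ?_) fun k _ _ ↦ by positivity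
        rw [mem_filter, mem_range] at hk
        exact mem_Ico.2 ⟨Nat.find_min' hex hk.2, hk.1⟩
    _ = (1 - c⁻¹)⁻¹ * ∑ k ∈ Ico k₀ K, c⁻¹ ^ k := by rw [mul_sum]
    _ ≤ (1 - c⁻¹)⁻¹ * (c⁻¹ ^ k₀ / (1 - c⁻¹)) := by
        gcongr
        exact geom_sum_Ico_le_of_lt_one (by positivity) (inv_lt_one_of_one_lt₀ hc)
    _ = (1 - c⁻¹)⁻¹ ^ 2 * (c ^ k₀)⁻¹ := by rw [inv_pow]; ring
    _ ≤ (1 - c⁻¹)⁻¹ ^ 2 * ((j : ℝ) + 1)⁻¹ := by gcongr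
    _ = _ := by rw [div_eq_mul_inv]

/-- If `∑ G j` converges, then the averages `N⁻¹ ∑_{j < N} (2 j + 1) G j` are summable along
`N = ⌊c ^ k⌋₊`. -/
theorem summable_weighted_average_floor_pow {c : ℝ} (hc : 1 < c) (G : ℕ → ℝ) (hG0 : ∀ j, 0 ≤ G j)
    (hG : Summable G) :
    Summable fun k ↦ ((⌊c ^ k⌋₊ : ℝ))⁻¹ * ∑ j ∈ range ⌊c ^ k⌋₊, (2 * (j : ℝ) + 1) * G j := by
  refine summable_of_sum_range_le (c := 2 * (1 - c⁻¹)⁻¹ ^ 2 * ∑' j, G j)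
    (fun k ↦ mul_nonneg (by positivity) (sum_nonneg fun j _ ↦ mul_nonneg (by positivity) (hG0 j)))
    fun K ↦ ?_
  simp_rw [mul_sum]
  rw [sum_comm' (s' := fun j ↦ {k ∈ range K | j < ⌊c ^ k⌋₊})
    (t' := (range K).biUnion fun k ↦ range ⌊c ^ k⌋₊)
    (by intro k j; simp only [mem_range, mem_filter, mem_biUnion]; grind)]
  calc ∑ j ∈ (range K).biUnion fun k ↦ range ⌊c ^ k⌋₊, ∑ k ∈ range K with j < ⌊c ^ k⌋₊,
        ((⌊c ^ k⌋₊ : ℝ))⁻¹ * ((2 * (j : ℝ) + 1) * G j)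
      ≤ ∑ j ∈ (range K).biUnion fun k ↦ range ⌊c ^ k⌋₊, 2 * (1 - c⁻¹)⁻¹ ^ 2 * G j := by
        refine sum_le_sum fun j _ ↦ ?_
        rw [← sum_mul]
        have hj : (0 : ℝ) < j + 1 := by positivity
        calc _ ≤ (1 - c⁻¹)⁻¹ ^ 2 / (j + 1) * ((2 * (j : ℝ) + 2) * G j) := by
              have := hG0 j
              gcongr
              · exact sum_inv_nat_floor_pow_le hc j K
              · norm_num
          _ = _ := by field_simp
    _ = 2 * (1 - c⁻¹)⁻¹ ^ 2 * ∑ j ∈ (range K).biUnion fun k ↦ range ⌊c ^ k⌋₊, G j := by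
        rw [mul_sum]
    _ ≤ _ := by
        gcongr
        exact hG.sum_le_tsum _ fun j _ ↦ hG0 j

theorem min_natCast_sq_le_sum {x : ℝ} (hx : 0 ≤ x) (n : ℕ) :
    min x n ^ 2 ≤ ∑ j ∈ range n, (2 * (j : ℝ) + 1) * if (j : ℝ) < x then 1 else 0 := by
  induction n with
  | zero => simp [hx]
  | succ n ih =>
    rw [sum_range_succ]
    split_ifs with h
    · rw [min_eq_right h.le] at ih
      have h0 : 0 ≤ min x ((n + 1 : ℕ) : ℝ) := by positivity
      have h1 : min x ((n + 1 : ℕ) : ℝ) ≤ n + 1 := by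
        rw [← Nat.cast_succ]; exact min_le_right _ _
      nlinarith
    · push Not at h
      rw [min_eq_left (h.trans (by simp))]
      rw [min_eq_left h] at ih
      simpa using ih

theorem sum_ite_natCast_lt_le {x : ℝ} (hx : 0 ≤ x) (n : ℕ) :
    ∑ j ∈ range n, (if (j : ℝ) < x then (1 : ℝ) else 0) ≤ x + 1 := by
  suffices h : ∑ j ∈ range n, (if (j : ℝ) < x then (1 : ℝ) else 0) ≤ min (x + 1) n from
    h.trans (min_le_left _ _)
  induction n with
  | zero => simp; linarith
  | succ n ih =>
    obtain ⟨h1, h2⟩ := le_min_iff.1 ih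
    rw [sum_range_succ, le_min_iff]
    push_cast
    split_ifs with h <;> constructor <;> linarith

section Probability

variable {Ω : Type*} [MeasurableSpace Ω] {P : Measure Ω}

theorem integral_ite_lt_eq_real {Z : Ω → ℝ} (hZ : Measurable Z) (a : ℝ) :
    ∫ ω, (if a < Z ω then (1 : ℝ) else 0) ∂P = P.real {ω | a < Z ω} := by
  rw [← integral_indicator_one (measurableSet_lt measurable_const hZ)]
  rfl

theorem norm_sq_eq_integral_sq (f : Lp ℝ 2 P) : ‖f‖ ^ 2 = ∫ ω, f ω ^ 2 ∂P := by
  rw [← real_inner_self_eq_norm_sq, L2.inner_def]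
  simp [pow_two]

variable [IsProbabilityMeasure P]

theorem integrable_ite_lt {Z : Ω → ℝ} (hZ : Measurable Z) (a : ℝ) :
    Integrable (fun ω ↦ if a < Z ω then (1 : ℝ) else 0) P :=
  (integrable_const (1 : ℝ)).indicator (measurableSet_lt measurable_const hZ)

theorem sum_real_natCast_lt_le {Z : Ω → ℝ} (hZ : Measurable Z) (hpos : 0 ≤ᵐ[P] Z)
    (hint : Integrable Z P) (n : ℕ) :
    ∑ j ∈ range n, P.real {ω | (j : ℝ) < Z ω} ≤ ∫ ω, Z ω ∂P + 1 := by
  simp_rw [← integral_ite_lt_eq_real hZ]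
  rw [← integral_finsetSum _ fun j _ ↦ integrable_ite_lt hZ _]
  calc _ ≤ ∫ ω, (Z ω + 1) ∂P := by
        refine integral_mono_ae (integrable_finsetSum _ fun j _ ↦ integrable_ite_lt hZ _)
          (hint.add (integrable_const _)) ?_
        filter_upwards [hpos] with ω h using sum_ite_natCast_lt_le h n
    _ = _ := by rw [integral_add hint (integrable_const _)]; simp

theorem memLp_min_natCast {Z : Ω → ℝ} (hZ : Measurable Z) (hpos : 0 ≤ᵐ[P] Z) (n : ℕ) :
    MemLp (fun ω ↦ min (Z ω) n) 2 P := by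
  refine MemLp.of_bound (hZ.min measurable_const).aestronglyMeasurable n ?_
  filter_upwards [hpos] with ω h
  rw [Real.norm_of_nonneg (le_min h (by positivity))]
  exact min_le_right _ _

theorem norm_toLp_min_sq_le {Z : Ω → ℝ} (hZ : Measurable Z) (hpos : 0 ≤ᵐ[P] Z) (n : ℕ) :
    ‖(memLp_min_natCast hZ hpos n).toLp‖ ^ 2 ≤
      ∑ j ∈ range n, (2 * (j : ℝ) + 1) * P.real {ω | (j : ℝ) < Z ω} := by
  have hi : ∀ j ∈ range n, Integrable
      (fun ω ↦ (2 * (j : ℝ) + 1) * if (j : ℝ) < Z ω then (1 : ℝ) else 0) P :=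
    fun j _ ↦ (integrable_ite_lt hZ _).const_mul _
  simp_rw [← integral_ite_lt_eq_real hZ, ← integral_const_mul]
  rw [norm_sq_eq_integral_sq, ← integral_finsetSum _ hi]
  refine integral_mono_ae (Lp.memLp _).integrable_sq (integrable_finsetSum _ hi) ?_
  filter_upwards [hpos, (memLp_min_natCast hZ hpos n).coeFn_toLp] with ω h h'
  simp only [h']
  exact min_natCast_sq_le_sum h n

/-- Weak `L²` limits of sequences increasing in a parameter `n`, with bounded integrals, converge
almost everywhere as `n → ∞`. -/
theorem ae_exists_tendsto_of_weak_limit_monotone {U : Filter ℕ} [U.NeBot]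
    (T : ℕ → ℕ → Lp ℝ 2 P) (β : ℕ → Lp ℝ 2 P) (B : ℝ)
    (hmono : ∀ m n, T m n ≤ᵐ[P] T m (n + 1)) (hB : ∀ m n, ∫ ω, T m n ω ∂P ≤ B)
    (hβ : ∀ n g, Filter.Tendsto (fun m ↦ inner ℝ (T m n) g) U (nhds (inner ℝ (β n) g))) :
    ∀ᵐ ω ∂P, ∃ l, Filter.Tendsto (fun n ↦ β n ω) Filter.atTop (nhds l) := by
  have hint : ∀ f : Lp ℝ 2 P, Integrable f P := fun f ↦ (Lp.memLp f).integrable one_le_two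
  have hset : ∀ n {s : Set Ω}, MeasurableSet s →
      Filter.Tendsto (fun m ↦ ∫ ω in s, T m n ω ∂P) U (nhds (∫ ω in s, β n ω ∂P)) := by
    intro n s hs
    have := hβ n (indicatorConstLp 2 hs (measure_ne_top P s) 1)
    simp_rw [real_inner_comm (indicatorConstLp 2 hs (measure_ne_top P s) (1 : ℝ))] at this
    simpa only [L2.inner_indicatorConstLp_one] using this
  have hinc : ∀ n, 0 ≤ᵐ[P] fun ω ↦ β (n + 1) ω - β n ω := by
    intro n
    refine ae_nonneg_of_forall_setIntegral_nonneg ((hint _).sub (hint _)) fun s hs _ ↦ ?_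
    rw [integral_sub (hint _).integrableOn (hint _).integrableOn, sub_nonneg]
    exact le_of_tendsto_of_tendsto' (hset n hs) (hset (n + 1) hs) fun m ↦
      setIntegral_mono_ae (hint _).integrableOn (hint _).integrableOn (hmono m n)
  have hβB : ∀ n, ∫ ω, β n ω ∂P ≤ B := by
    intro n
    have := hset n MeasurableSet.univ
    simp only [setIntegral_univ] at this
    exact le_of_tendsto' this fun m ↦ hB m n
  have hsum : Summable fun n ↦ ∫ ω, (β (n + 1) ω - β n ω) ∂P := by
    refine summable_of_sum_range_le (c := B - ∫ ω, β 0 ω ∂P)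
      (fun n ↦ integral_nonneg_of_ae (hinc n)) fun N ↦ ?_
    simp_rw [fun n ↦ integral_sub (hint (β (n + 1))) (hint (β n))]
    rw [sum_range_sub fun n ↦ ∫ ω, β n ω ∂P]
    linarith [hβB N]
  filter_upwards [ae_summable_of_summable_integral _ (fun n ↦ (hint _).sub (hint _)) hinc hsum]
    with ω hω
  refine ⟨_, (hω.hasSum.tendsto_sum_nat.add_const (β 0 ω)).congr fun N ↦ ?_⟩
  simp only [Pi.sub_apply]
  rw [sum_range_sub fun n ↦ β n ω]
  ring

theorem ae_tendsto_average_of_summable_norm_sq (D : ℕ → Lp ℝ 2 P) (N : ℕ → ℕ)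
    (hsum : Summable fun k ↦ ((N k : ℝ)⁻¹) ^ 2 * ‖∑ n ∈ range (N k), D n‖ ^ 2) :
    ∀ᵐ ω ∂P, Filter.Tendsto (fun k ↦ (N k : ℝ)⁻¹ * ∑ n ∈ range (N k), D n ω)
      Filter.atTop (nhds 0) := by
  have hcoe : ∀ᵐ ω ∂P, ∀ M, (∑ n ∈ range M, D n : Lp ℝ 2 P) ω = ∑ n ∈ range M, D n ω := by
    rw [ae_all_iff]
    intro M
    induction M with
    | zero => simp
    | succ M ih =>
      rw [sum_range_succ]
      filter_upwards [ih, Lp.coeFn_add (∑ n ∈ range M, D n) (D M)] with ω h1 h2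
      rw [h2, Pi.add_apply, h1, sum_range_succ]
  simp_rw [norm_sq_eq_integral_sq, ← integral_const_mul] at hsum
  filter_upwards [hcoe, ae_summable_of_summable_integral _
    (fun k ↦ ((Lp.memLp (∑ n ∈ range (N k), D n)).integrable_sq.const_mul _))
    (fun k ↦ Filter.Eventually.of_forall fun ω ↦ by positivity) hsum] with ω h1 h2
  have h3 := h2.tendsto_atTop_zero
  simp_rw [h1, ← mul_pow] at h3
  have h4 := h3.sqrt
  simp_rw [Real.sqrt_sq_eq_abs, Real.sqrt_zero] at h4
  exact (tendsto_zero_iff_abs_tendsto_zero _).2 h4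

theorem summable_inv_nat_floor_pow {c : ℝ} (hc : 1 < c) :
    Summable fun k ↦ ((⌊c ^ k⌋₊ : ℝ))⁻¹ := by
  have c0 : 0 < c := by linarith
  have hA : 0 < 1 - c⁻¹ := sub_pos.2 (inv_lt_one_of_one_lt₀ hc)
  refine Summable.of_nonneg_of_le (fun k ↦ by positivity) (fun k ↦ ?_)
    ((summable_geometric_of_lt_one (by positivity) (inv_lt_one_of_one_lt₀ hc)).mul_left
      (1 - c⁻¹)⁻¹)
  rw [inv_pow, ← mul_inv]
  exact inv_anti₀ (by positivity) (mul_pow_le_nat_floor_pow hc k)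

/-- If the tails of `Z n` are controlled by a summable sequence, and the truncations `min (Z n) n`
are, up to convergent terms, almost orthogonal in `L²`, then the Cesàro means of `Z` converge
almost everywhere. -/
theorem ae_exists_tendsto_cesaro_of_almost_orthogonal (Z : ℕ → Ω → ℝ) (hZ : ∀ n, Measurable (Z n))
    (hpos : ∀ n, 0 ≤ᵐ[P] Z n) (G ε : ℕ → ℝ) (hG0 : ∀ j, 0 ≤ G j) (hG : Summable G)
    (hε : ∀ n, ε n = (((n : ℝ) + 1) ^ 2)⁻¹)
    (htail : ∀ n : ℕ, ∀ j : ℕ, j ≤ n → P.real {ω | (j : ℝ) < Z n ω} ≤ G j + ε n)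
    (D b : ℕ → Lp ℝ 2 P) (hD : ∀ n, D n + b n = (memLp_min_natCast (hZ n) (hpos n) n).toLp)
    (hb : ∀ᵐ ω ∂P, ∃ l, Filter.Tendsto (fun n ↦ b n ω) Filter.atTop (nhds l))
    (hDb : ∀ n, -ε n ≤ inner ℝ (D n) (b n))
    (hDD : ∀ n, ∀ j < n, inner ℝ (D j) (D n) ≤ ε n) :
    ∀ᵐ ω ∂P, ∃ l, Filter.Tendsto (fun N : ℕ ↦ (N : ℝ)⁻¹ * ∑ n ∈ range N, Z n ω)
      Filter.atTop (nhds l) := by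
  have hε0 : ∀ n, 0 ≤ ε n := fun n ↦ by rw [hε]; positivity
  have hεsum : Summable ε := by
    have := (summable_nat_add_iff 1).2 (Real.summable_nat_pow_inv.2 one_lt_two)
    refine this.congr fun n ↦ ?_
    rw [hε]; push_cast; rfl
  set h : ℕ → ℝ := fun N ↦ ∑ j ∈ range N, (2 * (j : ℝ) + 1) * G j with hh
  have hh_mono : Monotone h := fun M N hMN ↦
    sum_le_sum_of_subset_of_nonneg (range_mono hMN) fun j _ _ ↦ mul_nonneg (by positivity) (hG0 j)
  have hodd : ∀ n : ℕ, ∑ j ∈ range n, (2 * (j : ℝ) + 1) = (n : ℝ) ^ 2 := by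
    intro n
    induction n with
    | zero => simp
    | succ n ih => rw [sum_range_succ, ih]; push_cast; ring
  have hDnorm : ∀ n, ‖D n‖ ^ 2 + 2 * (n * ε n) ≤ h n + 2 := by
    intro n
    have h1 : ‖D n + b n‖ ^ 2 ≤ h n + (n : ℝ) ^ 2 * ε n := by
      rw [hD n]
      refine (norm_toLp_min_sq_le (hZ n) (hpos n) n).trans ?_
      rw [← hodd, sum_mul, hh, ← sum_add_distrib]
      refine sum_le_sum fun j hj ↦ ?_
      rw [← mul_add]
      gcongr
      exact htail n j (mem_range.1 hj).le
    rw [norm_add_sq_real] at h1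
    have h2 : ((n : ℝ) + 1) ^ 2 * ε n = 1 := by
      rw [hε]; exact mul_inv_cancel₀ (by positivity)
    nlinarith [hDb n, sq_nonneg ‖b n‖, mul_nonneg (sq_nonneg (n : ℝ)) (hε0 n),
      mul_nonneg (Nat.cast_nonneg (α := ℝ) n) (hε0 n)]
  have hSnorm : ∀ N : ℕ, ‖∑ n ∈ range N, D n‖ ^ 2 ≤ N * (h N + 2) := by
    intro N
    refine (norm_sum_range_sq_le D ε hDD N).trans ?_
    have := sum_le_card_nsmul (range N) (fun n ↦ ‖D n‖ ^ 2 + 2 * (n * ε n)) (h N + 2) fun n hn ↦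
      (hDnorm n).trans (by gcongr; exact hh_mono (mem_range.1 hn).le)
    rwa [card_range, nsmul_eq_mul] at this
  have havg : ∀ c : ℝ, 1 < c → ∀ᵐ ω ∂P, Filter.Tendsto
      (fun k : ℕ ↦ (⌊c ^ k⌋₊ : ℝ)⁻¹ * ∑ n ∈ range ⌊c ^ k⌋₊, D n ω) Filter.atTop (nhds 0) := by
    intro c hc
    refine ae_tendsto_average_of_summable_norm_sq D (fun k ↦ ⌊c ^ k⌋₊) ?_
    refine Summable.of_nonneg_of_le (fun k ↦ by positivity) (fun k ↦ ?_)
      ((summable_weighted_average_floor_pow hc G hG0 hG).add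
        ((summable_inv_nat_floor_pow hc).mul_right 2))
    have hN : (0 : ℝ) < ⌊c ^ k⌋₊ :=
      Nat.cast_pos.2 (Nat.floor_pos.2 (one_le_pow₀ hc.le))
    calc _ ≤ ((⌊c ^ k⌋₊ : ℝ)⁻¹) ^ 2 * (⌊c ^ k⌋₊ * (h ⌊c ^ k⌋₊ + 2)) := by
          gcongr; exact hSnorm _
      _ = (⌊c ^ k⌋₊ : ℝ)⁻¹ * h ⌊c ^ k⌋₊ + (⌊c ^ k⌋₊ : ℝ)⁻¹ * 2 := by field_simp
  have hlarge : ∀ᵐ ω ∂P, ∀ᶠ n : ℕ in Filter.atTop, ω ∉ {ω | (n : ℝ) < Z n ω} := by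
    refine ae_eventually_notMem ?_
    simp_rw [← fun n : ℕ ↦ ofReal_measureReal (μ := P) (s := {ω | (n : ℝ) < Z n ω})]
    exact (Summable.of_nonneg_of_le (fun n ↦ measureReal_nonneg) (fun n ↦ htail n n le_rfl)
      (hG.add hεsum)).tsum_ofReal_ne_top
  have hDcoe : ∀ᵐ ω ∂P, ∀ n, D n ω + b n ω = min (Z n ω) n := by
    rw [ae_all_iff]
    intro n
    filter_upwards [Lp.coeFn_add (D n) (b n), (memLp_min_natCast (hZ n) (hpos n) n).coeFn_toLp]
      with ω h1 h2
    rw [← Pi.add_apply, ← h1, hD, h2]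
  obtain ⟨c, -, hc1, hclim⟩ := exists_seq_strictAnti_tendsto (1 : ℝ)
  filter_upwards [hb, hlarge, hDcoe, ae_all_iff.2 hpos, ae_all_iff.2 fun i ↦ havg (c i) (hc1 i)]
    with ω ⟨l, hl⟩ hlarge hDcoe hpos havg
  refine ⟨l, ?_⟩
  have htrunc : Filter.Tendsto (fun N : ℕ ↦ (∑ n ∈ range N, min (Z n ω) n) / N)
      Filter.atTop (nhds l) := by
    refine tendsto_div_of_monotone_of_tendsto_div_floor_pow _ l
      (fun M N hMN ↦ sum_le_sum_of_subset_of_nonneg (range_mono hMN) fun n _ _ ↦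
        le_min (hpos n) (Nat.cast_nonneg n)) c hc1 hclim fun i ↦ ?_
    have hfloor : Filter.Tendsto (fun k : ℕ ↦ ⌊c i ^ k⌋₊) Filter.atTop Filter.atTop :=
      tendsto_nat_floor_atTop.comp (tendsto_pow_atTop_atTop_of_one_lt (hc1 i))
    have := (havg i).add (hl.cesaro.comp hfloor)
    rw [zero_add] at this
    refine this.congr fun k ↦ ?_
    simp only [Function.comp_apply, ← mul_add, ← sum_add_distrib, hDcoe]
    rw [div_eq_inv_mul]
  have hdiff : Filter.Tendsto (fun n ↦ Z n ω - min (Z n ω) n) Filter.atTop (nhds 0) := by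
    refine tendsto_const_nhds.congr' ?_
    filter_upwards [hlarge] with n hn
    rw [min_eq_left (not_lt.1 hn), sub_self]
  have := htrunc.add hdiff.cesaro
  rw [add_zero] at this
  refine this.congr fun N ↦ ?_
  rw [div_eq_inv_mul, ← mul_add, ← sum_add_distrib]
  simp

/-- Komlós's theorem for nonnegative random variables, along an ultrafilter `U`: there are
conditions, satisfied by `U`-most choices of the next index, which ensure that the Cesàro means of
the chosen subsequence converge almost everywhere. -/
theorem exists_selection_ae_tendsto_cesaro (U : Ultrafilter ℕ) (X : ℕ → Ω → ℝ)
    (hX : ∀ n, Measurable (X n)) (hpos : ∀ n, 0 ≤ᵐ[P] X n) (hint : ∀ n, Integrable (X n) P)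
    (B : ℝ) (hB : ∀ n, ∫ ω, X n ω ∂P ≤ B) :
    ∃ (S : ℕ → ℕ → Prop) (R : ℕ → ℕ → ℕ → ℕ → Prop),
      (∀ n, ∀ᶠ m in U, S n m) ∧ (∀ j i n, ∀ᶠ m in U, R j i n m) ∧
      ∀ φ : ℕ → ℕ, (∀ n, S n (φ n)) → (∀ n, ∀ j < n, R j (φ j) n (φ n)) →
        ∀ᵐ ω ∂P, ∃ l, Filter.Tendsto (fun N : ℕ ↦ (N : ℝ)⁻¹ * ∑ n ∈ range N, X (φ n) ω)
          Filter.atTop (nhds l) := by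
  let ε : ℕ → ℝ := fun n ↦ (((n : ℝ) + 1) ^ 2)⁻¹
  have hε0 : ∀ n, 0 < ε n := fun n ↦ by positivity
  let T : ℕ → ℕ → Lp ℝ 2 P := fun m n ↦ (memLp_min_natCast (hX m) (hpos m) n).toLp
  have hTcoe : ∀ m n, T m n =ᵐ[P] fun ω ↦ min (X m ω) n := fun m n ↦
    (memLp_min_natCast (hX m) (hpos m) n).coeFn_toLp
  let g : ℕ → ℕ → ℝ := fun m j ↦ P.real {ω | (j : ℝ) < X m ω}
  choose G hG using fun j ↦ exists_tendsto_of_mem_Icc U (fun m ↦ g m j) 0 1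
    fun m ↦ ⟨measureReal_nonneg, measureReal_le_one⟩
  have hG0 : ∀ j, 0 ≤ G j := fun j ↦ ge_of_tendsto' (hG j) fun m ↦ measureReal_nonneg
  have hGsum : Summable G := summable_of_sum_range_le (c := B + 1) hG0 fun N ↦
    le_of_tendsto' (tendsto_finsetSum (range N) fun j _ ↦ hG j) fun m ↦
      (sum_real_natCast_lt_le (hX m) (hpos m) (hint m) N).trans (by gcongr; exact hB m)
  have hTnorm : ∀ m n, ‖T m n‖ ≤ √(∑ j ∈ range n, (2 * (j : ℝ) + 1)) := by
    intro m n
    refine Real.le_sqrt_of_sq_le ((norm_toLp_min_sq_le (hX m) (hpos m) n).trans ?_)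
    exact sum_le_sum fun j _ ↦ mul_le_of_le_one_right (by positivity) measureReal_le_one
  choose β hβ using fun n ↦ exists_tendsto_inner_of_norm_le U (fun m ↦ T m n) _ fun m ↦ hTnorm m n
  have hsub : ∀ n f, Filter.Tendsto (fun m ↦ inner ℝ (T m n - β n) f) U (nhds 0) := by
    intro n f
    simp_rw [inner_sub_left]
    simpa using (hβ n f).sub_const (inner ℝ (β n) f)
  have hβlim : ∀ᵐ ω ∂P, ∃ l, Filter.Tendsto (fun n ↦ β n ω) Filter.atTop (nhds l) := by
    refine ae_exists_tendsto_of_weak_limit_monotone (U := U) T β B (fun m n ↦ ?_) (fun m n ↦ ?_) hβ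
    · filter_upwards [hTcoe m n, hTcoe m (n + 1)] with ω h1 h2
      rw [h1, h2]
      gcongr
      simp
    · refine (integral_mono_ae ((Lp.memLp _).integrable one_le_two) (hint m) ?_).trans (hB m)
      filter_upwards [hTcoe m n] with ω h1
      rw [h1]
      exact min_le_left _ _
  refine ⟨fun n m ↦ (∀ j ∈ Set.Iic n, g m j ≤ G j + ε n) ∧ -ε n ≤ inner ℝ (T m n - β n) (β n),
    fun j i n m ↦ inner ℝ (T m n - β n) (T i j - β j) ≤ ε n, fun n ↦ ?_, fun j i n ↦ ?_,
    fun φ hS hR ↦ ?_⟩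
  · refine Filter.Eventually.and ?_ ?_
    · exact (Filter.eventually_all_finite (Set.finite_Iic n)).2 fun j _ ↦
        (hG j).eventually_le_const (by linarith [hε0 n])
    · exact (hsub n _).eventually_const_le (by linarith [hε0 n])
  · exact (hsub n _).eventually_le_const (hε0 n)
  · exact ae_exists_tendsto_cesaro_of_almost_orthogonal (fun n ↦ X (φ n)) (fun n ↦ hX _)
      (fun n ↦ hpos _) G ε hG0 hGsum (fun n ↦ rfl) (fun n ↦ (hS n).1)
      (fun n ↦ T (φ n) n - β n) β (fun n ↦ sub_add_cancel _ _) hβlim (fun n ↦ (hS n).2)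
      fun n j hj ↦ by rw [real_inner_comm]; exact hR n j hj

end Probability

/-- d-dimensional Komlós theorem: if `(X n)` are nonnegative
`ℝ^d`-valued random vectors with `sup_n E[X n i] < ∞` for each component `i`,
then there are a subsequence `(X (φ k))` and a random vector `Y` such that the
Cesàro means `(1/N) Σ_{k<N} X (φ k)` converge to `Y` almost surely. -/
theorem komlos_d_dim
    {Ω : Type*} [MeasurableSpace Ω] (P : Measure Ω) [IsProbabilityMeasure P]
    {d : ℕ} (X : ℕ → Ω → Fin d → ℝ)
    (hXmeas : ∀ n, Measurable (X n))
    (hXpos : ∀ n, ∀ᵐ ω ∂P, ∀ i, 0 ≤ X n ω i)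
    (hint : ∀ n i, Integrable (fun ω ↦ X n ω i) P)
    (hbdd : ∀ i, ∃ B : ℝ, ∀ n, ∫ ω, X n ω i ∂P ≤ B) :
    ∃ φ : ℕ → ℕ, StrictMono φ ∧ ∃ Y : Ω → Fin d → ℝ,
      ∀ᵐ ω ∂P, Filter.Tendsto
        (fun N : ℕ ↦ (N : ℝ)⁻¹ • ∑ k ∈ Finset.range N, X (φ k) ω)
        Filter.atTop (nhds (Y ω)) := by
  choose B hB using hbdd
  choose S R hS hR hSR using fun i ↦ exists_selection_ae_tendsto_cesaro (P := P)
    (Filter.hyperfilter ℕ) (fun n ω ↦ X n ω i) (fun n ↦ (measurable_pi_apply i).comp (hXmeas n))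
    (fun n ↦ by filter_upwards [hXpos n] with ω h using h i) (fun n ↦ hint n i) (B i) (hB i)
  obtain ⟨φ, hφS, hφR⟩ := exists_seq_of_forall_exists (fun n m ↦ ∀ i, S i n m)
    (fun j p n m ↦ p < m ∧ ∀ i, R i j p n m) fun n p ↦ by
      have h1 : ∀ᶠ m in (Filter.hyperfilter ℕ : Filter ℕ), ∀ i, S i n m :=
        Filter.eventually_all.2 fun i ↦ hS i n
      have h2 : ∀ᶠ m in (Filter.hyperfilter ℕ : Filter ℕ),
          ∀ j ∈ Set.Iio n, p j < m ∧ ∀ i, R i j (p j) n m :=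
        (Filter.eventually_all_finite (Set.finite_Iio n)).2 fun j _ ↦
          ((Filter.eventually_gt_atTop (p j)).filter_mono Nat.hyperfilter_le_atTop).and
            (Filter.eventually_all.2 fun i ↦ hR i j (p j) n)
      exact (h1.and h2).exists
  have hlim : ∀ᵐ ω ∂P, ∀ i, ∃ l, Filter.Tendsto
      (fun N : ℕ ↦ (N : ℝ)⁻¹ * ∑ n ∈ range N, X (φ n) ω i) Filter.atTop (nhds l) :=
    ae_all_iff.2 fun i ↦ hSR i φ (fun n ↦ hφS n i) fun n j hj ↦ (hφR n j hj).2 i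
  refine ⟨φ, fun j n hjn ↦ (hφR n j hjn).1, fun ω i ↦ Filter.limUnder Filter.atTop
    fun N : ℕ ↦ (N : ℝ)⁻¹ * ∑ n ∈ range N, X (φ n) ω i, ?_⟩
  filter_upwards [hlim] with ω hω
  refine tendsto_pi_nhds.2 fun i ↦ ?_
  simpa only [Pi.smul_apply, Finset.sum_apply, smul_eq_mul] using tendsto_nhds_limUnder (hω i)
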